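/- Let B be a standard Brownian motion and a a bounded adapted real process with ‖a‖_∞ ≤ K. Define M_t := exp(∫₀^t a_s dB_s − ½∫₀^t a_s² ds) and Y_t := M_t ( ∫₀^t e^{−(t−s)} M_s^{−2} ds )^{1/2} for t > 0. Then sup_{t ≥ 1} E(Y_t) < ∞, with a bound depending only on K. -/

import Mathlib

open MeasureTheory

lemma aux_exp_neg_le {y : ℝ} (hy : 0 ≤ y) : Real.exp (-y) ≤ 1 - y + y ^ 2 / 2 := by
  have h1 := Real.quadratic_le_exp_of_nonneg hy
  have h2 : 0 < 1 - y + y ^ 2 / 2 := by nlinarith [sq_nonneg (y - 1)]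
  rw [Real.exp_neg, inv_le_iff_one_le_mul₀ (Real.exp_pos y)]
  nlinarith [mul_le_mul_of_nonneg_left h1 h2.le, sq_nonneg (y ^ 2)]

lemma aux_g_pos (x : ℝ) : 0 < 1 + x + x ^ 2 / 2 := by nlinarith [sq_nonneg (x + 1)]

lemma aux_exp_le (x : ℝ) : Real.exp x ≤ (1 + x + x ^ 2 / 2) * Real.exp (|x| ^ 3) := by
  have hg := aux_g_pos x
  rcases le_total 0 x with hx | hx
  · rw [abs_of_nonneg hx]
    rcases le_total x 1 with h1 | h1
    · have h2 := Real.exp_bound' hx h1 (n := 3) (by norm_num)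
      simp [Finset.sum_range_succ, Nat.factorial] at h2
      have h3 := Real.add_one_le_exp (x ^ 3)
      have h4 : 0 ≤ x ^ 3 := by positivity
      have h5 : (1 + x + x ^ 2 / 2) * (x ^ 3 + 1) ≤ (1 + x + x ^ 2 / 2) * Real.exp (x ^ 3) := by
        gcongr
      have h6 : 0 ≤ (x + x ^ 2 / 2) * x ^ 3 := by positivity
      nlinarith
    · have : Real.exp x ≤ Real.exp (x ^ 3) := by
        apply Real.exp_le_exp.2
        nlinarith [mul_nonneg (sub_nonneg.2 h1) hx, sq_nonneg x]
      have h6 : 0 ≤ (x + x ^ 2 / 2) * Real.exp (x ^ 3) := by positivity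
      nlinarith
  · have := aux_exp_neg_le (neg_nonneg.2 hx)
    simp at this
    have h3 := Real.add_one_le_exp (|x| ^ 3)
    have h4 : 0 ≤ |x| ^ 3 := by positivity
    nlinarith

lemma aux_one_step {x q κ δ : ℝ} (hq : 0 ≤ q) (hqκ : q ≤ κ) (hδ : 0 < δ) :
    (1 + x + x ^ 2 / 2) * Real.exp (-(q / 2)) ≤
      (1 + x + x ^ 2 / 2 - q / 2) + (κ / 4 * (x ^ 2 / δ + δ) + κ ^ 2 / 8 * (3 / 2 + x ^ 2)) := by
  have h1 := aux_exp_neg_le (y := q / 2) (by linarith)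
  have hg := aux_g_pos x
  have hκ : 0 ≤ κ := hq.trans hqκ
  have h2 : |x| ≤ (x ^ 2 / δ + δ) / 2 := by
    rw [le_div_iff₀ two_pos, div_add' _ _ _ hδ.ne', le_div_iff₀ hδ]
    nlinarith [sq_nonneg (|x| - δ), sq_abs x]
  have h3 : - x * q ≤ κ * ((x ^ 2 / δ + δ) / 2) := by
    calc - x * q ≤ |x| * q := by gcongr; exact neg_le_abs x
      _ ≤ ((x ^ 2 / δ + δ) / 2) * κ := by gcongr
      _ = _ := by ring
  have h4 : (1 + x + x ^ 2 / 2) * q ^ 2 ≤ (3 / 2 + x ^ 2) * κ ^ 2 := by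
    refine mul_le_mul ?_ (by gcongr) (by positivity) (by positivity)
    nlinarith [sq_nonneg (x - 1)]
  have h5 := mul_le_mul_of_nonneg_left h1 hg.le
  have h6 : 0 ≤ x ^ 2 * q := by positivity
  nlinarith

structure QVData {Ω : Type*} {mΩ : MeasurableSpace Ω} (μ : Measure Ω) (ℱ : Filtration ℝ mΩ)
    (N A : ℝ → Ω → ℝ) (κ : ℝ) : Prop where
  N_mart : Martingale N ℱ μ
  Q_mart : Martingale (fun t ω => N t ω ^ 2 - A t ω) ℱ μ
  cont : ∀ ω, Continuous fun t => N t ω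
  A_int : ∀ t, Integrable (A t) μ
  A_lo : ∀ s t ω, s ≤ t → 0 ≤ A t ω - A s ω
  A_hi : ∀ s t ω, s ≤ t → A t ω - A s ω ≤ κ * (t - s)

lemma aux_weight {Ω : Type*} {mΩ : MeasurableSpace Ω} {μ : Measure Ω} {m : MeasurableSpace Ω}
    (hm : m ≤ mΩ) {X : Ω → ENNReal} (hX : Measurable[mΩ] X) {c : ENNReal}
    (h : ∀ F, MeasurableSet[m] F → ∫⁻ ω in F, X ω ∂μ ≤ c * μ F)
    {W : Ω → ENNReal} (hW : Measurable[m] W) :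
    ∫⁻ ω, W ω * X ω ∂μ ≤ c * ∫⁻ ω, W ω ∂μ := by
  have hle : (μ.withDensity X).trim hm ≤ (c • μ).trim hm := by
    refine Measure.le_iff.2 fun F hF => ?_
    rw [trim_measurableSet_eq hm hF, trim_measurableSet_eq hm hF,
      withDensity_apply _ (hm _ hF)]
    simpa using h F hF
  have h1 := lintegral_mono' hle (le_refl W)
  rw [lintegral_trim hm hW, lintegral_trim hm hW,
    lintegral_withDensity_eq_lintegral_mul μ hX (hW.mono hm le_rfl), lintegral_smul_measure] at h1
  simpa [mul_comm] using h1

namespace QVData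

variable {Ω : Type*} {mΩ : MeasurableSpace Ω} {μ : Measure Ω} {ℱ : Filtration ℝ mΩ}
    {N A : ℝ → Ω → ℝ} {κ : ℝ}

lemma N_meas (h : QVData μ ℱ N A κ) {s t : ℝ} (hst : s ≤ t) : Measurable[ℱ t] (N s) :=
  ((h.N_mart.1 s).mono (ℱ.mono hst)).measurable

lemma A_meas (h : QVData μ ℱ N A κ) {s t : ℝ} (hst : s ≤ t) : Measurable[ℱ t] (A s) := by
  have h1 : Measurable[ℱ t] (fun ω => N s ω ^ 2 - A s ω) :=
    ((h.Q_mart.1 s).mono (ℱ.mono hst)).measurable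
  have h2 := ((h.N_meas hst).pow_const 2).sub h1
  convert h2 using 1
  ext ω
  simp

lemma N_sq_int (h : QVData μ ℱ N A κ) (t : ℝ) : Integrable (fun ω => N t ω ^ 2) μ := by
  have h1 := (h.Q_mart.integrable t).add (h.A_int t)
  refine h1.congr (Filter.Eventually.of_forall fun ω => ?_)
  simp

lemma N_memLp (h : QVData μ ℱ N A κ) (t : ℝ) : MemLp (N t) 2 μ :=
  (memLp_two_iff_integrable_sq ((h.N_mart.integrable t).aestronglyMeasurable)).2 (h.N_sq_int t)

lemma xi_sq_int (h : QVData μ ℱ N A κ) (s t : ℝ) :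
    Integrable (fun ω => (N t ω - N s ω) ^ 2) μ :=
  ((h.N_memLp t).sub (h.N_memLp s)).integrable_sq

lemma set_xi [IsFiniteMeasure μ] (h : QVData μ ℱ N A κ) {s t : ℝ} (hst : s ≤ t) {F : Set Ω}
    (hF : MeasurableSet[ℱ s] F) : ∫ ω in F, (N t ω - N s ω) ∂μ = 0 := by
  rw [integral_sub (h.N_mart.integrable t).integrableOn (h.N_mart.integrable s).integrableOn,
    h.N_mart.setIntegral_eq hst hF, sub_self]

lemma set_xi_sq [IsFiniteMeasure μ] (h : QVData μ ℱ N A κ) {s t : ℝ} (hst : s ≤ t) {F : Set Ω}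
    (hF : MeasurableSet[ℱ s] F) :
    ∫ ω in F, (N t ω - N s ω) ^ 2 ∂μ = ∫ ω in F, (A t ω - A s ω) ∂μ := by
  have hNN : Integrable (N s * N t) μ := (h.N_memLp s).integrable_mul (h.N_memLp t)
  have h1 : μ[N s * N t | ℱ s] =ᵐ[μ] N s * N s := by
    filter_upwards [condExp_mul_of_stronglyMeasurable_left (h.N_mart.1 s) hNN
      (h.N_mart.integrable t), h.N_mart.2 s t hst] with ω h1 h2
    rw [h1]; simp [h2]
  have h2 : ∫ ω in F, N s ω * N t ω ∂μ = ∫ ω in F, N s ω ^ 2 ∂μ := by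
    have := setIntegral_condExp (ℱ.le s) hNN hF
    rw [setIntegral_congr_ae (g := N s * N s) ((ℱ.le s) _ hF) (h1.mono fun ω hω _ => hω)] at this
    simp only [Pi.mul_apply] at this
    rw [← this]; simp [sq]
  have h3 := h.Q_mart.setIntegral_eq hst hF
  rw [integral_sub (h.N_sq_int s).integrableOn (h.A_int s).integrableOn,
    integral_sub (h.N_sq_int t).integrableOn (h.A_int t).integrableOn] at h3
  rw [integral_sub (h.A_int t).integrableOn (h.A_int s).integrableOn]
  have h4 : ∫ ω in F, (N t ω - N s ω) ^ 2 ∂μ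
      = ∫ ω in F, ((N t ω ^ 2 + N s ω ^ 2) - 2 * (N s ω * N t ω)) ∂μ := by
    congr 1; ext ω; ring
  have hNN' : Integrable (fun ω => N s ω * N t ω) μ := hNN
  have hadd : Integrable (fun ω => N t ω ^ 2 + N s ω ^ 2) (μ.restrict F) :=
    ((h.N_sq_int t).add (h.N_sq_int s)).integrableOn
  rw [h4, integral_sub hadd (hNN'.const_mul 2).integrableOn, integral_add (h.N_sq_int t).integrableOn
    (h.N_sq_int s).integrableOn, integral_const_mul, h2]
  linarith

lemma set_xi_sq_le [IsFiniteMeasure μ] (h : QVData μ ℱ N A κ) {s t : ℝ} (hst : s ≤ t) {F : Set Ω}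
    (hF : MeasurableSet[ℱ s] F) :
    ∫ ω in F, (N t ω - N s ω) ^ 2 ∂μ ≤ κ * (t - s) * μ.real F := by
  rw [h.set_xi_sq hst hF]
  have := setIntegral_mono (μ := μ) (s := F) (f := fun ω => A t ω - A s ω)
    (g := fun _ => κ * (t - s)) ((h.A_int t).sub (h.A_int s)).integrableOn
    (integrable_const _).integrableOn (fun ω => h.A_hi s t ω hst)
  simpa [mul_comm] using this

/-- one-step factor -/
noncomputable def G (N A : ℝ → Ω → ℝ) (s t : ℝ) (ω : Ω) : ℝ :=
  (1 + (N t ω - N s ω) + (N t ω - N s ω) ^ 2 / 2) * Real.exp (-((A t ω - A s ω) / 2))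

lemma G_pos (s t : ℝ) (ω : Ω) : 0 < G N A s t ω := mul_pos (aux_g_pos _) (Real.exp_pos _)

lemma G_meas (h : QVData μ ℱ N A κ) {s t u : ℝ} (hs : s ≤ u) (ht : t ≤ u) :
    Measurable[ℱ u] (G N A s t) := by
  have h1 := h.N_meas hs
  have h2 := h.N_meas ht
  have h3 := h.A_meas hs
  have h4 := h.A_meas ht
  unfold G
  fun_prop

lemma set_G [IsFiniteMeasure μ] (h : QVData μ ℱ N A κ) (hκ : 0 ≤ κ) {s t δ : ℝ} (hδ : 0 < δ)
    (hδ1 : δ ≤ 1) (hst : t - s = δ ^ 2) {F : Set Ω} (hF : MeasurableSet[ℱ s] F) :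
    ∫⁻ ω in F, ENNReal.ofReal (G N A s t ω) ∂μ ≤
      ENNReal.ofReal (1 + (1 + κ) ^ 3 * δ ^ 3) * μ F := by
  have hle : s ≤ t := by nlinarith [sq_nonneg δ]
  set k := κ * (t - s) with hk
  set R : Ω → ℝ := fun ω => (1 + (N t ω - N s ω) + (N t ω - N s ω) ^ 2 / 2 - (A t ω - A s ω) / 2) +
    (k / 4 * ((N t ω - N s ω) ^ 2 / δ + δ) + k ^ 2 / 8 * (3 / 2 + (N t ω - N s ω) ^ 2)) with hR
  have hGR : ∀ ω, G N A s t ω ≤ R ω := fun ω =>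
    aux_one_step (h.A_lo s t ω hle) (h.A_hi s t ω hle) hδ
  have i1 : Integrable (fun ω => N t ω - N s ω) (μ.restrict F) :=
    ((h.N_mart.integrable t).sub (h.N_mart.integrable s)).integrableOn
  have i2 : Integrable (fun ω => (N t ω - N s ω) ^ 2) (μ.restrict F) :=
    (h.xi_sq_int s t).integrableOn
  have i3 : Integrable (fun ω => A t ω - A s ω) (μ.restrict F) :=
    ((h.A_int t).sub (h.A_int s)).integrableOn
  have hRe : R = fun ω => (1 + k / 4 * δ + k ^ 2 / 8 * (3 / 2)) + (N t ω - N s ω)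
      + (1 / 2 + k / 4 / δ + k ^ 2 / 8) * (N t ω - N s ω) ^ 2 - (1 / 2) * (A t ω - A s ω) := by
    ext ω; simp only [hR]; ring
  have iR : Integrable R (μ.restrict F) := by
    rw [hRe]
    exact (((integrable_const _).add i1).add (i2.const_mul _)).sub (i3.const_mul _)
  have e : ∫ ω in F, R ω ∂μ = (1 + k / 4 * δ + k ^ 2 / 8 * (3 / 2)) * μ.real F
      + (k / 4 / δ + k ^ 2 / 8) * ∫ ω in F, (N t ω - N s ω) ^ 2 ∂μ := by
    have j1 : Integrable (fun ω => (1 + k / 4 * δ + k ^ 2 / 8 * (3 / 2)) + (N t ω - N s ω))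
      (μ.restrict F) := (integrable_const _).add i1
    have j2 : Integrable (fun ω => (1 + k / 4 * δ + k ^ 2 / 8 * (3 / 2)) + (N t ω - N s ω)
        + (1 / 2 + k / 4 / δ + k ^ 2 / 8) * (N t ω - N s ω) ^ 2)
      (μ.restrict F) := j1.add (i2.const_mul _)
    rw [hRe, integral_sub j2 (i3.const_mul _), integral_add j1 (i2.const_mul _),
      integral_add (integrable_const _) i1, integral_const_mul, integral_const_mul,
      h.set_xi hle hF, ← h.set_xi_sq hle hF]
    simp
    ring
  have hk0 : 0 ≤ k := by rw [hk, hst]; positivity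
  have e2 : ∫ ω in F, R ω ∂μ ≤ (1 + (1 + κ) ^ 3 * δ ^ 3) * μ.real F := by
    rw [e]
    have h1 := h.set_xi_sq_le hle hF
    rw [← hk] at h1
    have h2 := mul_le_mul_of_nonneg_left h1 (show 0 ≤ k / 4 / δ + k ^ 2 / 8 by positivity)
    have h3 : (1 + k / 4 * δ + k ^ 2 / 8 * (3 / 2)) + (k / 4 / δ + k ^ 2 / 8) * k
        ≤ 1 + (1 + κ) ^ 3 * δ ^ 3 := by
      have hkd : k / 4 / δ = κ * δ / 4 := by rw [hk, hst]; field_simp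
      rw [hkd, hk, hst]
      have a1 : κ ^ 2 * δ ^ 4 ≤ κ ^ 2 * δ ^ 3 :=
        mul_le_mul_of_nonneg_left (pow_le_pow_of_le_one hδ.le hδ1 (by norm_num)) (by positivity)
      have a2 : κ ^ 3 * δ ^ 6 ≤ κ ^ 3 * δ ^ 3 :=
        mul_le_mul_of_nonneg_left (pow_le_pow_of_le_one hδ.le hδ1 (by norm_num)) (by positivity)
      have b0 : 0 ≤ δ ^ 3 := by positivity
      have b1 : 0 ≤ κ * δ ^ 3 := by positivity
      have b2 : 0 ≤ κ ^ 2 * δ ^ 3 := by positivity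
      have b3 : 0 ≤ κ ^ 3 * δ ^ 3 := by positivity
      nlinarith
    have h4 := mul_le_mul_of_nonneg_right h3 (measureReal_nonneg (μ := μ) (s := F))
    nlinarith
  calc ∫⁻ ω in F, ENNReal.ofReal (G N A s t ω) ∂μ ≤ ∫⁻ ω in F, ENNReal.ofReal (R ω) ∂μ :=
        lintegral_mono fun ω => ENNReal.ofReal_le_ofReal (hGR ω)
    _ = ENNReal.ofReal (∫ ω in F, R ω ∂μ) := by
        rw [ofReal_integral_eq_lintegral_ofReal iR]
        exact Filter.Eventually.of_forall fun ω => (G_pos s t ω).le.trans (hGR ω)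
    _ ≤ ENNReal.ofReal ((1 + (1 + κ) ^ 3 * δ ^ 3) * μ.real F) := ENNReal.ofReal_le_ofReal e2
    _ = _ := by
        rw [ENNReal.ofReal_mul (by positivity)]
        simp [Measure.real]

lemma prod_G [IsFiniteMeasure μ] (h : QVData μ ℱ N A κ) (hκ : 0 ≤ κ) {s δ : ℝ} (hδ : 0 < δ)
    (hδ1 : δ ≤ 1) {F : Set Ω} (hF : MeasurableSet[ℱ s] F) (n : ℕ) :
    ∫⁻ ω in F, ENNReal.ofReal (∏ i ∈ Finset.range n,
        G N A (s + i * δ ^ 2) (s + (i + 1 : ℕ) * δ ^ 2) ω) ∂μ ≤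
      ENNReal.ofReal ((1 + (1 + κ) ^ 3 * δ ^ 3) ^ n) * μ F := by
  induction n with
  | zero => simp
  | succ n ih =>
    have hsn : s ≤ s + n * δ ^ 2 := by have : 0 ≤ n * δ ^ 2 := by positivity
                                       linarith
    have hFm : MeasurableSet[ℱ (s + n * δ ^ 2)] F := ℱ.mono hsn _ hF
    have hprod : Measurable[ℱ (s + n * δ ^ 2)] (fun ω => ∏ i ∈ Finset.range n,
        G N A (s + i * δ ^ 2) (s + (i + 1 : ℕ) * δ ^ 2) ω) := by
      refine Finset.measurable_fun_prod _ fun i hi => ?_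
      have hi : i + 1 ≤ n := Finset.mem_range.1 hi
      have hi' : (i : ℝ) ≤ n := by exact_mod_cast (Nat.le_of_succ_le hi)
      have hi'' : ((i + 1 : ℕ) : ℝ) ≤ n := by exact_mod_cast hi
      exact h.G_meas (by gcongr) (by gcongr)
    have hW : Measurable[ℱ (s + n * δ ^ 2)] (F.indicator fun ω => ENNReal.ofReal
        (∏ i ∈ Finset.range n, G N A (s + i * δ ^ 2) (s + (i + 1 : ℕ) * δ ^ 2) ω)) :=
      (ENNReal.measurable_ofReal.comp hprod).indicator hFm
    have hG : Measurable (fun ω => ENNReal.ofReal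
        (G N A (s + n * δ ^ 2) (s + (n + 1 : ℕ) * δ ^ 2) ω)) :=
      ENNReal.measurable_ofReal.comp ((h.G_meas (u := s + (n + 1 : ℕ) * δ ^ 2)
        (by gcongr; simp) le_rfl).mono (ℱ.le _) le_rfl)
    have key := aux_weight (ℱ.le (s + n * δ ^ 2)) hG (fun E hE => h.set_G
      (s := s + n * δ ^ 2) (t := s + (n + 1 : ℕ) * δ ^ 2) hκ hδ hδ1 (by push_cast; ring) hE) hW
    have hF' : MeasurableSet F := ℱ.le _ _ hF
    calc _ = ∫⁻ ω, (F.indicator fun ω => ENNReal.ofReal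
        (∏ i ∈ Finset.range n, G N A (s + i * δ ^ 2) (s + (i + 1 : ℕ) * δ ^ 2) ω)) ω *
          ENNReal.ofReal (G N A (s + n * δ ^ 2) (s + (n + 1 : ℕ) * δ ^ 2) ω) ∂μ := by
          rw [← lintegral_indicator hF']
          congr 1; ext ω
          by_cases hω : ω ∈ F
          · simp only [Set.indicator_of_mem hω]
            rw [Finset.prod_range_succ, ENNReal.ofReal_mul]
            exact Finset.prod_nonneg fun i _ => (G_pos _ _ _).le
          · simp [hω]
      _ ≤ _ := key
      _ ≤ ENNReal.ofReal (1 + (1 + κ) ^ 3 * δ ^ 3) *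
            (ENNReal.ofReal ((1 + (1 + κ) ^ 3 * δ ^ 3) ^ n) * μ F) := by
          rw [lintegral_indicator hF']
          gcongr
      _ = _ := by
          rw [← mul_assoc, ← ENNReal.ofReal_mul (by positivity),
            pow_succ' (1 + (1 + κ) ^ 3 * δ ^ 3) n]

end QVData

lemma aux_prod (m : ℕ) (x : ℕ → ℝ) {ε : ℝ} (hx : ∀ i < m, |x i| ≤ ε) :
    Real.exp (∑ i ∈ Finset.range m, x i) ≤ (∏ i ∈ Finset.range m, (1 + x i + x i ^ 2 / 2)) *
      Real.exp (ε * ∑ i ∈ Finset.range m, x i ^ 2) := by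
  rw [Finset.mul_sum, Real.exp_sum, Real.exp_sum, ← Finset.prod_mul_distrib]
  refine Finset.prod_le_prod (fun i _ => (Real.exp_pos _).le) fun i hi => ?_
  refine (aux_exp_le (x i)).trans ?_
  have := hx i (Finset.mem_range.1 hi)
  have hg := (aux_g_pos (x i)).le
  gcongr
  rw [pow_succ', sq_abs]
  gcongr

lemma aux_min (m : ℕ) (x : ℕ → ℝ) {ε L D : ℝ} (hε : 0 ≤ ε) (hL : 0 ≤ L)
    (hx : ∀ i < m, |x i| ≤ ε) :
    min (Real.exp ((∑ i ∈ Finset.range m, x i) - D)) L ≤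
      (∏ i ∈ Finset.range m, (1 + x i + x i ^ 2 / 2)) * Real.exp (-D) +
        L * ε * ∑ i ∈ Finset.range m, x i ^ 2 := by
  have h1 := aux_prod m x hx
  set S := ∑ i ∈ Finset.range m, x i ^ 2 with hS
  set P := ∏ i ∈ Finset.range m, (1 + x i + x i ^ 2 / 2) with hP
  have hS0 : 0 ≤ S := Finset.sum_nonneg fun i _ => sq_nonneg _
  have h2 : Real.exp ((∑ i ∈ Finset.range m, x i) - D) * Real.exp (-(ε * S)) ≤
      P * Real.exp (-D) := by
    rw [sub_eq_add_neg, Real.exp_add]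
    calc _ ≤ P * Real.exp (ε * S) * Real.exp (-D) * Real.exp (-(ε * S)) := by gcongr
      _ = P * Real.exp (-D) * (Real.exp (ε * S) * Real.exp (-(ε * S))) := by ring
      _ = _ := by rw [← Real.exp_add]; simp
  set X := Real.exp ((∑ i ∈ Finset.range m, x i) - D)
  have hm0 : 0 ≤ min X L := le_min (Real.exp_pos _).le hL
  have h3 : min X L * (1 - ε * S) ≤ X * Real.exp (-(ε * S)) := by
    calc _ ≤ min X L * Real.exp (-(ε * S)) := by
          gcongr
          linarith [Real.add_one_le_exp (-(ε * S))]
      _ ≤ _ := by gcongr; exact min_le_left _ _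
  have h4 : min X L * (ε * S) ≤ L * (ε * S) := by gcongr; exact min_le_right _ _
  nlinarith

namespace QVData

variable {Ω : Type*} {mΩ : MeasurableSpace Ω} {μ : Measure Ω} {ℱ : Filtration ℝ mΩ}
    {N A : ℝ → Ω → ℝ} {κ : ℝ}

lemma limit_bound [IsFiniteMeasure μ] (h : QVData μ ℱ N A κ) (hκ : 0 ≤ κ) {s t δ : ℝ}
    (hδ : 0 < δ) (hδ1 : δ ≤ 1) (n : ℕ) (hn : s + n * δ ^ 2 = t)
    {F : Set Ω} (hF : MeasurableSet[ℱ s] F) {ε L : ℝ} (hε : 0 ≤ ε) (hL : 0 ≤ L) :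
    ∫⁻ ω in F, ENNReal.ofReal (min (Real.exp (N t ω - N s ω - (A t ω - A s ω) / 2)) L) ∂μ ≤
      ENNReal.ofReal (Real.exp ((1 + κ) ^ 3 * (t - s) * δ)) * μ F +
      ENNReal.ofReal (L * ε * (κ * (t - s) * μ.real F)) +
      ENNReal.ofReal L * μ {ω | ∃ i ∈ Finset.range n,
        ε < |N (s + (i + 1 : ℕ) * δ ^ 2) ω - N (s + i * δ ^ 2) ω|} := by
  set B := {ω | ∃ i ∈ Finset.range n,
        ε < |N (s + (i + 1 : ℕ) * δ ^ 2) ω - N (s + i * δ ^ 2) ω|} with hB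
  have hNm : ∀ u, Measurable (N u) := fun u => (h.N_meas le_rfl).mono (ℱ.le u) le_rfl
  have hBm : MeasurableSet B := by
    have : B = ⋃ i ∈ Finset.range n, {ω | 
        ε < |N (s + (i + 1 : ℕ) * δ ^ 2) ω - N (s + i * δ ^ 2) ω|} := by
      ext ω; simp [hB]
    rw [this]
    refine Finset.measurableSet_biUnion _ fun i _ => ?_
    exact measurableSet_lt measurable_const (((hNm _).sub (hNm _)).abs)
  have hsumN : ∀ ω, ∑ i ∈ Finset.range n,
      (N (s + (i + 1 : ℕ) * δ ^ 2) ω - N (s + i * δ ^ 2) ω) = N t ω - N s ω := fun ω => by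
    rw [Finset.sum_range_sub (fun i : ℕ => N (s + i * δ ^ 2) ω), hn]; simp
  have hsumA : ∀ ω, ∑ i ∈ Finset.range n,
      (A (s + (i + 1 : ℕ) * δ ^ 2) ω - A (s + i * δ ^ 2) ω) = A t ω - A s ω := fun ω => by
    rw [Finset.sum_range_sub (fun i : ℕ => A (s + i * δ ^ 2) ω), hn]; simp
  have hG : ∀ ω, ∏ i ∈ Finset.range n, G N A (s + i * δ ^ 2) (s + (i + 1 : ℕ) * δ ^ 2) ω =
      (∏ i ∈ Finset.range n, (1 + (N (s + (i + 1 : ℕ) * δ ^ 2) ω - N (s + i * δ ^ 2) ω) +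
        (N (s + (i + 1 : ℕ) * δ ^ 2) ω - N (s + i * δ ^ 2) ω) ^ 2 / 2)) *
      Real.exp (-((A t ω - A s ω) / 2)) := fun ω => by
    unfold G
    rw [Finset.prod_mul_distrib, ← Real.exp_sum, Finset.sum_neg_distrib, ← Finset.sum_div, hsumA]
  have hpt : ∀ ω, ENNReal.ofReal (min (Real.exp (N t ω - N s ω - (A t ω - A s ω) / 2)) L) ≤
      ENNReal.ofReal (∏ i ∈ Finset.range n, G N A (s + i * δ ^ 2) (s + (i + 1 : ℕ) * δ ^ 2) ω) +
      ENNReal.ofReal (L * ε * ∑ i ∈ Finset.range n,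
        (N (s + (i + 1 : ℕ) * δ ^ 2) ω - N (s + i * δ ^ 2) ω) ^ 2) +
      B.indicator (fun _ => ENNReal.ofReal L) ω := fun ω => by
    by_cases hω : ω ∈ B
    · rw [Set.indicator_of_mem hω]
      exact le_add_left (ENNReal.ofReal_le_ofReal (min_le_right _ _))
    · rw [Set.indicator_of_notMem hω, add_zero, ← ENNReal.ofReal_add
        (Finset.prod_nonneg fun i _ => (G_pos _ _ _).le)
        (mul_nonneg (by positivity) (Finset.sum_nonneg fun i _ => sq_nonneg _))]
      apply ENNReal.ofReal_le_ofReal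
      rw [hG, ← hsumN]
      refine aux_min n (fun i => N (s + (i + 1 : ℕ) * δ ^ 2) ω - N (s + i * δ ^ 2) ω) hε hL ?_
      intro i hi
      by_contra hc
      exact hω ⟨i, Finset.mem_range.2 hi, not_le.1 hc⟩
  have hGm : Measurable fun ω => ENNReal.ofReal
      (∏ i ∈ Finset.range n, G N A (s + i * δ ^ 2) (s + (i + 1 : ℕ) * δ ^ 2) ω) :=
    ENNReal.measurable_ofReal.comp (Finset.measurable_fun_prod _ fun i hi =>
      (h.G_meas (le_max_left _ _) (le_max_right _ _)).mono (ℱ.le _) le_rfl)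
  have hSm : Measurable fun ω => ENNReal.ofReal (L * ε * ∑ i ∈ Finset.range n,
        (N (s + (i + 1 : ℕ) * δ ^ 2) ω - N (s + i * δ ^ 2) ω) ^ 2) :=
    ENNReal.measurable_ofReal.comp ((Finset.measurable_fun_sum _ fun i hi =>
      ((hNm _).sub (hNm _)).pow_const 2).const_mul _)
  have hδ2 : (n : ℝ) * δ ^ 2 = t - s := by linarith
  refine (lintegral_mono hpt).trans ?_
  rw [lintegral_add_right _ (measurable_const.indicator hBm), lintegral_add_left hGm]
  refine add_le_add (add_le_add ?_ ?_) ?_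
  · refine (h.prod_G hκ hδ hδ1 hF n).trans ?_
    gcongr
    calc _ ≤ (Real.exp ((1 + κ) ^ 3 * δ ^ 3)) ^ n := by
          gcongr
          linarith [Real.add_one_le_exp ((1 + κ) ^ 3 * δ ^ 3)]
      _ = _ := by
          rw [← Real.exp_nat_mul, ← hδ2]
          congr 1; ring
  · have hIntg : ∀ i ∈ Finset.range n, Integrable (fun ω =>
        (N (s + (i + 1 : ℕ) * δ ^ 2) ω - N (s + i * δ ^ 2) ω) ^ 2) (μ.restrict F) :=
      fun i _ => (h.xi_sq_int _ _).integrableOn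
    rw [← ofReal_integral_eq_lintegral_ofReal ((integrable_finset_sum _ hIntg).const_mul _)
      (Filter.Eventually.of_forall fun ω => mul_nonneg (by positivity)
        (Finset.sum_nonneg fun i _ => sq_nonneg _))]
    rw [integral_const_mul, integral_finset_sum _ hIntg]
    apply ENNReal.ofReal_le_ofReal
    gcongr
    calc _ ≤ ∑ i ∈ Finset.range n, κ * δ ^ 2 * μ.real F := by
          refine Finset.sum_le_sum fun i _ => ?_
          have hp : 0 ≤ (i : ℝ) * δ ^ 2 := by positivity
          have := h.set_xi_sq_le (s := s + i * δ ^ 2) (t := s + (i + 1 : ℕ) * δ ^ 2)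
            (by gcongr; simp) (ℱ.mono (by linarith) _ hF)
          have e : s + (i + 1 : ℕ) * δ ^ 2 - (s + i * δ ^ 2) = δ ^ 2 := by push_cast; ring
          rwa [e] at this
      _ = _ := by
          rw [Finset.sum_const, Finset.card_range, nsmul_eq_mul, ← hδ2]; ring
  · rw [lintegral_indicator hBm, lintegral_const, Measure.restrict_restrict hBm]
    rw [Measure.restrict_apply_univ]
    exact mul_le_mul' le_rfl (measure_mono Set.inter_subset_left)

lemma aux_bad (f : ℝ → ℝ) (hf : Continuous f) {s t : ℝ} (hst : s < t) {ε : ℝ} (hε : 0 < ε) :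
    ∀ᶠ n : ℕ in Filter.atTop, ¬ ∃ i ∈ Finset.range (n + 1),
      ε < |f (s + (i + 1 : ℕ) * √((t - s) / (n + 1)) ^ 2) -
        f (s + i * √((t - s) / (n + 1)) ^ 2)| := by
  have hu := isCompact_Icc.uniformContinuousOn_of_continuous (hf.continuousOn (s := Set.Icc s t))
  obtain ⟨d, hd, hd'⟩ := Metric.uniformContinuousOn_iff.1 hu ε hε
  have hlim : Filter.Tendsto (fun n : ℕ => (t - s) / ((n : ℝ) + 1)) Filter.atTop (nhds 0) :=
    tendsto_const_nhds.div_atTop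
      (Filter.tendsto_atTop_add_const_right _ _ tendsto_natCast_atTop_atTop)
  filter_upwards [hlim.eventually (gt_mem_nhds hd)] with n hn
  have hts : 0 < t - s := sub_pos.2 hst
  have hn0 : (0 : ℝ) < n + 1 := by positivity
  have hp : 0 < (t - s) / ((n : ℝ) + 1) := by positivity
  rintro ⟨i, hi, hlt⟩
  rw [Real.sq_sqrt hp.le] at hlt
  have hi : i + 1 ≤ n + 1 := Finset.mem_range.1 hi
  have hi1 : ((i + 1 : ℕ) : ℝ) ≤ n + 1 := by exact_mod_cast hi
  have hi0 : (i : ℝ) ≤ (i + 1 : ℕ) := by simp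
  have hmul : ((n : ℝ) + 1) * ((t - s) / ((n : ℝ) + 1)) = t - s := by field_simp
  have ha := mul_le_mul_of_nonneg_right hi1 hp.le
  have hb := mul_le_mul_of_nonneg_right hi0 hp.le
  have hc : 0 ≤ (i : ℝ) * ((t - s) / ((n : ℝ) + 1)) := by positivity
  have := hd' (s + (i + 1 : ℕ) * ((t - s) / (n + 1))) ⟨by linarith, by linarith⟩
    (s + i * ((t - s) / (n + 1))) ⟨by linarith, by linarith⟩ (by
      rw [Real.dist_eq]
      have : s + (i + 1 : ℕ) * ((t - s) / (n + 1)) - (s + i * ((t - s) / (n + 1)))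
        = (t - s) / (n + 1) := by push_cast; ring
      rw [this, abs_of_pos hp]; exact hn)
  rw [Real.dist_eq] at this
  linarith

lemma limit_min_eps [IsFiniteMeasure μ] (h : QVData μ ℱ N A κ) (hκ : 0 ≤ κ) {s t : ℝ}
    (hst : s < t) {F : Set Ω} (hF : MeasurableSet[ℱ s] F) {ε L : ℝ} (hε : 0 < ε) (hL : 0 ≤ L) :
    ∫⁻ ω in F, ENNReal.ofReal (min (Real.exp (N t ω - N s ω - (A t ω - A s ω) / 2)) L) ∂μ ≤
      μ F + ENNReal.ofReal (L * ε * (κ * (t - s) * μ.real F)) := by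
  have hts : 0 < t - s := sub_pos.2 hst
  have hNm : ∀ u, Measurable (N u) := fun u => (h.N_meas le_rfl).mono (ℱ.le u) le_rfl
  set δ : ℕ → ℝ := fun n => √((t - s) / (n + 1)) with hδ
  have hδp : ∀ n, 0 < δ n := fun n => Real.sqrt_pos.2 (by positivity)
  have hlim : Filter.Tendsto (fun n : ℕ => (t - s) / ((n : ℝ) + 1)) Filter.atTop (nhds 0) :=
    tendsto_const_nhds.div_atTop
      (Filter.tendsto_atTop_add_const_right _ _ tendsto_natCast_atTop_atTop)
  have hδ0 : Filter.Tendsto δ Filter.atTop (nhds 0) := by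
    have := (Real.continuous_sqrt.tendsto 0).comp hlim
    simpa [Function.comp_def] using this
  have hB : Filter.Tendsto (fun n : ℕ => μ {ω | ∃ i ∈ Finset.range (n + 1),
        ε < |N (s + (i + 1 : ℕ) * δ n ^ 2) ω - N (s + i * δ n ^ 2) ω|}) Filter.atTop
        (nhds (μ ∅)) := by
    refine tendsto_measure_of_tendsto_indicator_of_isFiniteMeasure _ μ (fun n => ?_) fun ω => ?_
    · have : {ω | ∃ i ∈ Finset.range (n + 1),
        ε < |N (s + (i + 1 : ℕ) * δ n ^ 2) ω - N (s + i * δ n ^ 2) ω|}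
        = ⋃ i ∈ Finset.range (n + 1), {ω | 
          ε < |N (s + (i + 1 : ℕ) * δ n ^ 2) ω - N (s + i * δ n ^ 2) ω|} := by
        ext ω; simp
      rw [this]
      refine Finset.measurableSet_biUnion _ fun i _ => ?_
      exact measurableSet_lt measurable_const (((hNm _).sub (hNm _)).abs)
    · filter_upwards [aux_bad (fun u => N u ω) (h.cont ω) hst hε] with n hn
      exact iff_of_false hn (Set.notMem_empty _)
  rw [measure_empty] at hB
  have hE : Filter.Tendsto (fun n => ENNReal.ofReal (Real.exp ((1 + κ) ^ 3 * (t - s) * δ n)))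
      Filter.atTop (nhds 1) := by
    have h1 : Filter.Tendsto (fun n => Real.exp ((1 + κ) ^ 3 * (t - s) * δ n)) Filter.atTop
      (nhds (Real.exp ((1 + κ) ^ 3 * (t - s) * 0))) :=
      (Real.continuous_exp.tendsto _).comp (hδ0.const_mul _)
    have := (ENNReal.continuous_ofReal.tendsto _).comp h1
    simpa [Function.comp_def] using this
  have hT := ((ENNReal.Tendsto.mul_const hE (b := μ F) (Or.inr (measure_ne_top _ _))).add_const
    (ENNReal.ofReal (L * ε * (κ * (t - s) * μ.real F)))).add
    (ENNReal.Tendsto.const_mul hB (a := ENNReal.ofReal L) (Or.inr ENNReal.ofReal_ne_top))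
  rw [one_mul, mul_zero, add_zero] at hT
  refine ge_of_tendsto hT ?_
  filter_upwards [hδ0.eventually (ge_mem_nhds one_pos)] with n hn
  refine h.limit_bound hκ (hδp n) hn (n + 1) ?_ hF hε.le hL
  simp only [hδ]
  rw [Real.sq_sqrt (by positivity)]
  push_cast
  field_simp
  ring

lemma limit_min [IsFiniteMeasure μ] (h : QVData μ ℱ N A κ) (hκ : 0 ≤ κ) {s t : ℝ}
    (hst : s < t) {F : Set Ω} (hF : MeasurableSet[ℱ s] F) {L : ℝ} (hL : 0 ≤ L) :
    ∫⁻ ω in F, ENNReal.ofReal (min (Real.exp (N t ω - N s ω - (A t ω - A s ω) / 2)) L) ∂μ ≤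
      μ F := by
  have h1 : Filter.Tendsto (fun ε : ℝ => L * ε * (κ * (t - s) * μ.real F)) (nhdsWithin 0 (Set.Ioi 0))
      (nhds (L * 0 * (κ * (t - s) * μ.real F))) :=
    (Continuous.tendsto (by fun_prop) 0).mono_left nhdsWithin_le_nhds
  have h2 := ((ENNReal.continuous_ofReal.tendsto _).comp h1).const_add (μ F)
  simp only [mul_zero, zero_mul, ENNReal.ofReal_zero, add_zero] at h2
  refine ge_of_tendsto h2 ?_
  filter_upwards [self_mem_nhdsWithin] with ε hε
  exact h.limit_min_eps hκ hst hF hε hL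

/-- exponential increment -/
noncomputable def E (N A : ℝ → Ω → ℝ) (s t : ℝ) (ω : Ω) : ENNReal :=
  ENNReal.ofReal (Real.exp (N t ω - N s ω - (A t ω - A s ω) / 2))

lemma E_meas (h : QVData μ ℱ N A κ) (s t : ℝ) : Measurable (E N A s t) := by
  have hNm : ∀ u, Measurable (N u) := fun u => (h.N_meas le_rfl).mono (ℱ.le u) le_rfl
  have hAm : ∀ u, Measurable (A u) := fun u => (h.A_meas le_rfl).mono (ℱ.le u) le_rfl
  have h1 := hNm s
  have h2 := hNm t
  have h3 := hAm s
  have h4 := hAm t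
  unfold E
  fun_prop

lemma limit_set [IsFiniteMeasure μ] (h : QVData μ ℱ N A κ) (hκ : 0 ≤ κ) {s t : ℝ}
    (hst : s ≤ t) {F : Set Ω} (hF : MeasurableSet[ℱ s] F) :
    ∫⁻ ω in F, E N A s t ω ∂μ ≤ μ F := by
  rcases hst.eq_or_lt with rfl | hst
  · simp [E]
  have hNm : ∀ u, Measurable (N u) := fun u => (h.N_meas le_rfl).mono (ℱ.le u) le_rfl
  have hAm : ∀ u, Measurable (A u) := fun u => (h.A_meas le_rfl).mono (ℱ.le u) le_rfl
  have h1 := hNm s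
  have h2 := hNm t
  have h3 := hAm s
  have h4 := hAm t
  refine le_of_tendsto (lintegral_tendsto_of_tendsto_of_monotone (μ := μ.restrict F)
    (f := fun (n : ℕ) ω => ENNReal.ofReal
      (min (Real.exp (N t ω - N s ω - (A t ω - A s ω) / 2)) n)) (F := E N A s t) ?_ ?_ ?_)
    (Filter.Eventually.of_forall fun n => h.limit_min hκ hst hF (Nat.cast_nonneg n))
  · intro n
    exact (by fun_prop : Measurable _).aemeasurable
  · refine Filter.Eventually.of_forall fun ω n m hnm => ?_
    have : (n : ℝ) ≤ m := by exact_mod_cast hnm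
    dsimp only
    gcongr
  · refine Filter.Eventually.of_forall fun ω => ?_
    refine tendsto_const_nhds.congr' ?_
    obtain ⟨k, hk⟩ := exists_nat_ge (Real.exp (N t ω - N s ω - (A t ω - A s ω) / 2))
    filter_upwards [Filter.eventually_ge_atTop k] with n hn
    have : (k : ℝ) ≤ n := by exact_mod_cast hn
    rw [min_eq_left (hk.trans this)]; rfl

/-- supermartingale property -/
lemma super [IsFiniteMeasure μ] (h : QVData μ ℱ N A κ) (hκ : 0 ≤ κ) {s t : ℝ}
    (hst : s ≤ t) {W : Ω → ENNReal} (hW : Measurable[ℱ s] W) :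
    ∫⁻ ω, W ω * E N A s t ω ∂μ ≤ ∫⁻ ω, W ω ∂μ := by
  have := aux_weight (ℱ.le s) (h.E_meas s t) (c := 1)
    (fun F hF => by simpa using h.limit_set hκ hst hF) hW
  simpa using this

end QVData

lemma aux_rpow (x : ENNReal) : x ^ (1 / 2 : ℝ) ≤ 1 + x := by
  rcases le_total x 1 with h | h
  · exact (ENNReal.rpow_le_one h (by norm_num)).trans le_self_add
  · calc x ^ (1 / 2 : ℝ) ≤ x ^ (1 : ℝ) :=
          ENNReal.rpow_le_rpow_of_exponent_le h (by norm_num)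
      _ = x := ENNReal.rpow_one x
      _ ≤ _ := le_add_self

lemma aux_c : (ENNReal.ofReal (Real.exp (-1))) ^ (1 / 2 : ℝ) ≤ ENNReal.ofReal (2 / 3) := by
  rw [ENNReal.ofReal_rpow_of_nonneg (Real.exp_pos _).le (by norm_num), ← Real.sqrt_eq_rpow]
  apply ENNReal.ofReal_le_ofReal
  rw [Real.sqrt_le_left (by norm_num), Real.exp_neg,
    inv_le_comm₀ (Real.exp_pos _) (by norm_num)]
  have := Real.exp_one_gt_d9
  norm_num at this ⊢
  linarith

namespace QVData

variable {Ω : Type*} {mΩ : MeasurableSpace Ω} {μ : Measure Ω} {ℱ : Filtration ℝ mΩ}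
    {N A : ℝ → Ω → ℝ} {κ : ℝ}

/-- Doleans exponential -/
noncomputable def MM (N A : ℝ → Ω → ℝ) (t : ℝ) (ω : Ω) : ℝ := Real.exp (N t ω - (1 / 2) * A t ω)

/-- weighted inner integral -/
noncomputable def H (N A : ℝ → Ω → ℝ) (r t : ℝ) (ω : Ω) : ENNReal :=
  ∫⁻ s in Set.Ioc r t, ENNReal.ofReal (Real.exp (-(t - s)) * ((MM N A s ω)⁻¹) ^ 2)

lemma A_cont (h : QVData μ ℱ N A κ) (ω : Ω) : Continuous fun t => A t ω := by
  have : LipschitzWith (Real.toNNReal κ) fun t => A t ω := by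
    refine LipschitzWith.of_le_add_mul' κ fun x y => ?_
    rw [Real.dist_eq]
    rcases le_total x y with hxy | hxy
    · have h1 := h.A_lo x y ω hxy
      have h2 := h.A_hi x y ω hxy
      rw [abs_of_nonpos (by linarith)]
      linarith
    · have h2 := h.A_hi y x ω hxy
      rw [abs_of_nonneg (by linarith)]
      linarith
  exact this.continuous

lemma MM_meas (h : QVData μ ℱ N A κ) {s t : ℝ} (hst : s ≤ t) : Measurable[ℱ t] (MM N A s) := by
  have h1 := h.N_meas hst
  have h2 := h.A_meas hst
  unfold MM
  fun_prop

lemma MM_cont (h : QVData μ ℱ N A κ) (ω : Ω) : Continuous fun t => MM N A t ω := by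
  have h1 := h.cont ω
  have h2 := h.A_cont ω
  unfold MM
  fun_prop

lemma MM_pos (t : ℝ) (ω : Ω) : 0 < MM N A t ω := Real.exp_pos _

lemma H_meas (h : QVData μ ℱ N A κ) (r t : ℝ) : Measurable[ℱ t] (H N A r t) := by
  have e : H N A r t = fun ω => ∫⁻ s in Set.Ioc r t,
      ENNReal.ofReal (Real.exp (-(t - s)) * ((MM N A (min s t) ω)⁻¹) ^ 2) := by
    ext ω
    refine setLIntegral_congr_fun measurableSet_Ioc fun s hs => ?_
    simp only [min_eq_left hs.2]
  rw [e]
  letI : MeasurableSpace Ω := ℱ t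
  have hj : Measurable (Function.uncurry fun (s : ℝ) (ω : Ω) =>
      ENNReal.ofReal (Real.exp (-(t - s)) * ((MM N A (min s t) ω)⁻¹) ^ 2)) := by
    refine measurable_uncurry_of_continuous_of_measurable (fun ω => ?_) fun s => ?_
    · refine ENNReal.continuous_ofReal.comp ?_
      refine Continuous.mul (by fun_prop) (Continuous.pow ?_ 2)
      exact ((h.MM_cont ω).comp (by fun_prop)).inv₀ fun s => (MM_pos _ _).ne'
    · have := h.MM_meas (min_le_right s t)
      fun_prop
  exact Measurable.lintegral_prod_right' (hj.comp measurable_swap)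

lemma MM_step (s t : ℝ) (ω : Ω) :
    ENNReal.ofReal (MM N A t ω) = ENNReal.ofReal (MM N A s ω) * E N A s t ω := by
  unfold MM E
  rw [← ENNReal.ofReal_mul (Real.exp_pos _).le, ← Real.exp_add]
  congr 2; ring

lemma smul_two (h : QVData μ ℱ N A κ) :
    QVData μ ℱ (fun t ω => 2 * N t ω) (fun t ω => 4 * A t ω) (4 * κ) where
  N_mart := h.N_mart.smul 2
  Q_mart := by
    convert h.Q_mart.smul 4 using 1
    ext t ω
    simp; ring
  cont ω := (h.cont ω).const_mul 2
  A_int t := (h.A_int t).const_mul 4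
  A_lo s t ω hst := by have := h.A_lo s t ω hst; linarith
  A_hi s t ω hst := by have := h.A_hi s t ω hst; linarith

lemma ratio_sq [IsProbabilityMeasure μ] (h : QVData μ ℱ N A κ) (hκ : 0 ≤ κ) {s t : ℝ}
    (hst : s ≤ t) (hst1 : t - s ≤ 1) :
    ∫⁻ ω, ENNReal.ofReal (MM N A t ω ^ 2 * ((MM N A s ω)⁻¹) ^ 2) ∂μ ≤
      ENNReal.ofReal (Real.exp κ) := by
  have h2 := h.smul_two.super (by positivity) hst (W := fun _ => 1) measurable_const
  calc _ ≤ ∫⁻ ω, ENNReal.ofReal (Real.exp κ) *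
        E (fun t ω => 2 * N t ω) (fun t ω => 4 * A t ω) s t ω ∂μ := by
        refine lintegral_mono fun ω => ?_
        unfold E MM
        rw [← ENNReal.ofReal_mul (Real.exp_pos _).le, ← Real.exp_add, ← Real.exp_neg,
          ← Real.exp_nat_mul, ← Real.exp_nat_mul, ← Real.exp_add]
        apply ENNReal.ofReal_le_ofReal
        apply Real.exp_le_exp.2
        have := h.A_hi s t ω hst
        have : κ * (t - s) ≤ κ * 1 := by gcongr
        push_cast
        linarith
    _ = ENNReal.ofReal (Real.exp κ) *
        ∫⁻ ω, E (fun t ω => 2 * N t ω) (fun t ω => 4 * A t ω) s t ω ∂μ :=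
        lintegral_const_mul _ (h.smul_two.E_meas s t)
    _ ≤ ENNReal.ofReal (Real.exp κ) * 1 := by
        gcongr
        simpa using h2
    _ = _ := mul_one _

lemma first_block [IsProbabilityMeasure μ] (h : QVData μ ℱ N A κ) (hκ : 0 ≤ κ) (t : ℝ) :
    ∫⁻ ω, ENNReal.ofReal (MM N A t ω) * (H N A (t - 1) t ω) ^ (1 / 2 : ℝ) ∂μ ≤
      1 + ENNReal.ofReal (Real.exp κ) := by
  have hMm : ∀ u, Measurable (MM N A u) := fun u => (h.MM_meas le_rfl).mono (ℱ.le u) le_rfl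
  have hj : Measurable (Function.uncurry fun (s : ℝ) (ω : Ω) =>
      ENNReal.ofReal (MM N A t ω ^ 2 * ((MM N A s ω)⁻¹) ^ 2)) := by
    refine measurable_uncurry_of_continuous_of_measurable (fun ω => ?_) fun s => ?_
    · refine ENNReal.continuous_ofReal.comp ?_
      refine Continuous.mul (by fun_prop) (Continuous.pow ?_ 2)
      exact (h.MM_cont ω).inv₀ fun s => (MM_pos _ _).ne'
    · have h1 := hMm s
      have h2 := hMm t
      fun_prop
  have hpt : ∀ ω, ENNReal.ofReal (MM N A t ω) * (H N A (t - 1) t ω) ^ (1 / 2 : ℝ) ≤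
      1 + ∫⁻ s in Set.Ioc (t - 1) t, ENNReal.ofReal (MM N A t ω ^ 2 * ((MM N A s ω)⁻¹) ^ 2) := by
    intro ω
    have e1 : ENNReal.ofReal (MM N A t ω) = (ENNReal.ofReal (MM N A t ω ^ 2)) ^ (1 / 2 : ℝ) := by
      rw [ENNReal.ofReal_rpow_of_nonneg (by positivity) (by norm_num), ← Real.sqrt_eq_rpow,
        Real.sqrt_sq (MM_pos t ω).le]
    rw [e1, ← ENNReal.mul_rpow_of_nonneg _ _ (by norm_num)]
    refine (aux_rpow _).trans ?_
    gcongr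
    unfold H
    rw [← lintegral_const_mul' _ _ ENNReal.ofReal_ne_top]
    refine setLIntegral_mono' measurableSet_Ioc fun s hs => ?_
    rw [← ENNReal.ofReal_mul (by positivity)]
    apply ENNReal.ofReal_le_ofReal
    have : Real.exp (-(t - s)) ≤ 1 := Real.exp_le_one_iff.2 (by linarith [hs.2])
    gcongr
    exact mul_le_of_le_one_left (by positivity) this
  calc _ ≤ ∫⁻ ω, (1 + ∫⁻ s in Set.Ioc (t - 1) t,
          ENNReal.ofReal (MM N A t ω ^ 2 * ((MM N A s ω)⁻¹) ^ 2)) ∂μ := lintegral_mono hpt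
    _ = 1 + ∫⁻ ω, ∫⁻ s in Set.Ioc (t - 1) t,
          ENNReal.ofReal (MM N A t ω ^ 2 * ((MM N A s ω)⁻¹) ^ 2) ∂volume ∂μ := by
        rw [lintegral_add_left measurable_const]; simp
    _ = 1 + ∫⁻ s in Set.Ioc (t - 1) t, ∫⁻ ω,
          ENNReal.ofReal (MM N A t ω ^ 2 * ((MM N A s ω)⁻¹) ^ 2) ∂μ := by
        rw [lintegral_lintegral_swap]
        exact (hj.comp measurable_swap).aemeasurable
    _ ≤ 1 + ∫⁻ s in Set.Ioc (t - 1) t, ENNReal.ofReal (Real.exp κ) := by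
        gcongr 1 + ?_
        refine setLIntegral_mono' measurableSet_Ioc fun s hs => ?_
        exact h.ratio_sq hκ hs.2 (by linarith [hs.1])
    _ = _ := by simp

lemma all_blocks [IsProbabilityMeasure μ] (h : QVData μ ℱ N A κ) (hκ : 0 ≤ κ) (n : ℕ) :
    ∀ t : ℝ, ∫⁻ ω, ENNReal.ofReal (MM N A t ω) * (H N A (t - n) t ω) ^ (1 / 2 : ℝ) ∂μ ≤
      ENNReal.ofReal (3 * (1 + Real.exp κ)) := by
  induction n with
  | zero => intro t; simp [H]
  | succ n ih =>
    intro t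
    have hMm : ∀ u, Measurable (MM N A u) := fun u => (h.MM_meas le_rfl).mono (ℱ.le u) le_rfl
    have hHm : ∀ r u, Measurable (H N A r u) := fun r u => (h.H_meas r u).mono (ℱ.le u) le_rfl
    set c : ENNReal := (ENNReal.ofReal (Real.exp (-1))) ^ (1 / 2 : ℝ) with hc
    have hH : ∀ ω, H N A (t - (n + 1 : ℕ)) t ω =
        ENNReal.ofReal (Real.exp (-1)) * H N A (t - 1 - n) (t - 1) ω + H N A (t - 1) t ω := by
      intro ω
      have hn : (0 : ℝ) ≤ n := Nat.cast_nonneg n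
      unfold H
      rw [← lintegral_const_mul' _ _ ENNReal.ofReal_ne_top,
        ← Set.Ioc_union_Ioc_eq_Ioc (a := t - (n + 1 : ℕ)) (b := t - 1) (c := t)
          (by push_cast; linarith) (by linarith),
        lintegral_union measurableSet_Ioc (Set.Ioc_disjoint_Ioc_of_le le_rfl)]
      congr 1
      have : t - (n + 1 : ℕ) = t - 1 - n := by push_cast; ring
      rw [this]
      congr 1; ext s
      rw [← ENNReal.ofReal_mul (Real.exp_pos _).le, ← mul_assoc, ← Real.exp_add]
      congr 4; ring
    have hpt : ∀ ω, ENNReal.ofReal (MM N A t ω) * (H N A (t - (n + 1 : ℕ)) t ω) ^ (1 / 2 : ℝ) ≤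
        c * ((ENNReal.ofReal (MM N A (t - 1) ω) * (H N A (t - 1 - n) (t - 1) ω) ^ (1 / 2 : ℝ)) *
          E N A (t - 1) t ω) +
        ENNReal.ofReal (MM N A t ω) * (H N A (t - 1) t ω) ^ (1 / 2 : ℝ) := by
      intro ω
      rw [hH]
      calc _ ≤ ENNReal.ofReal (MM N A t ω) *
            ((ENNReal.ofReal (Real.exp (-1)) * H N A (t - 1 - n) (t - 1) ω) ^ (1 / 2 : ℝ) +
              (H N A (t - 1) t ω) ^ (1 / 2 : ℝ)) := by
            gcongr
            exact ENNReal.rpow_add_le_add_rpow _ _ (by norm_num) (by norm_num)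
        _ = _ := by
            rw [mul_add, ENNReal.mul_rpow_of_nonneg _ _ (by norm_num), ← hc,
              MM_step (t - 1) t ω]
            ring
    have hW : Measurable[ℱ (t - 1)] fun ω =>
        ENNReal.ofReal (MM N A (t - 1) ω) * (H N A (t - 1 - n) (t - 1) ω) ^ (1 / 2 : ℝ) := by
      have h1 := h.MM_meas (le_refl (t - 1))
      have h2 := h.H_meas (t - 1 - n) (t - 1)
      fun_prop
    have hm2 : Measurable fun ω =>
        ENNReal.ofReal (MM N A t ω) * (H N A (t - 1) t ω) ^ (1 / 2 : ℝ) := by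
      have h1 := hMm t
      have h2 := hHm (t - 1) t
      fun_prop
    have hm1 := (hW.mono (ℱ.le _) le_rfl).mul (h.E_meas (t - 1) t)
    refine (lintegral_mono hpt).trans ?_
    rw [lintegral_add_right _ hm2]
    calc _ ≤ ENNReal.ofReal (2 / 3) * ENNReal.ofReal (3 * (1 + Real.exp κ)) +
          (1 + ENNReal.ofReal (Real.exp κ)) := by
          refine add_le_add ?_ (h.first_block hκ t)
          refine (lintegral_const_mul c hm1).le.trans ?_
          exact mul_le_mul' aux_c ((h.super hκ (by linarith) hW).trans (ih (t - 1)))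
      _ = _ := by
          rw [← ENNReal.ofReal_one, ← ENNReal.ofReal_mul (by norm_num),
            ← ENNReal.ofReal_add (by norm_num) (Real.exp_pos _).le,
            ← ENNReal.ofReal_add (by positivity) (by positivity)]
          congr 1; ring

end QVData

lemma aux_ofReal_integral_le {α : Type*} {m : MeasurableSpace α} {ν : Measure α} {f : α → ℝ}
    (hf : ∀ x, 0 ≤ f x) : ENNReal.ofReal (∫ x, f x ∂ν) ≤ ∫⁻ x, ENNReal.ofReal (f x) ∂ν := by
  by_cases hi : Integrable f ν
  · rw [ofReal_integral_eq_lintegral_ofReal hi (Filter.Eventually.of_forall hf)]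
  · rw [integral_undef hi]; simp

lemma aux_qvdata {Ω : Type} {mΩ : MeasurableSpace Ω} {μ : Measure Ω} [IsProbabilityMeasure μ]
    {ℱ : Filtration ℝ mΩ} {a N : ℝ → Ω → ℝ} {K : ℝ}
    (ha : ∀ s ω, |a s ω| ≤ K) (hp : ProgMeasurable ℱ a) (hN : Martingale N ℱ μ)
    (hc : ∀ ω, Continuous fun t => N t ω)
    (hQ : Martingale (fun t ω => N t ω ^ 2 - ∫ s in Set.Ioc (0:ℝ) t, (a s ω)^2) ℱ μ) :
    QVData μ ℱ N (fun t ω => ∫ s in Set.Ioc (0:ℝ) t, (a s ω)^2) (K ^ 2) := by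
  have hsq : ∀ s ω, a s ω ^ 2 ≤ K ^ 2 := fun s ω => by
    rw [← sq_abs]; exact pow_le_pow_left₀ (abs_nonneg _) (ha s ω) 2
  have hIntg : ∀ t ω, IntegrableOn (fun s => a s ω ^ 2) (Set.Ioc 0 t) := by
    intro t ω
    have hm : Measurable fun s : ℝ => a (min s t) ω := by
      letI : MeasurableSpace Ω := ℱ t
      have h1 : Measurable fun p : Set.Iic t × Ω => a p.1 p.2 := (hp t).measurable
      exact h1.comp (g := fun p : Set.Iic t × Ω => a p.1 p.2)
        (f := fun s : ℝ => ((⟨min s t, min_le_right s t⟩ : Set.Iic t), ω))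
        ((Measurable.subtype_mk (by fun_prop)).prodMk measurable_const)
    have h2 : IntegrableOn (fun s => a (min s t) ω ^ 2) (Set.Ioc 0 t) := by
      refine Integrable.of_bound (hm.pow_const 2).aestronglyMeasurable (K ^ 2)
        (Filter.Eventually.of_forall fun s => ?_)
      rw [Real.norm_of_nonneg (sq_nonneg _)]
      exact hsq _ _
    refine h2.congr_fun (fun s hs => ?_) measurableSet_Ioc
    simp only [min_eq_left hs.2]
  have hdiff : ∀ s t ω, s ≤ t → (∫ u in Set.Ioc (0:ℝ) t, (a u ω)^2) -
      (∫ u in Set.Ioc (0:ℝ) s, (a u ω)^2) =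
      ∫ u in Set.Ioc (0:ℝ) t \ Set.Ioc 0 s, (a u ω)^2 := by
    intro s t ω hst
    rw [integral_diff measurableSet_Ioc (hIntg t ω) (Set.Ioc_subset_Ioc_right hst)]
  have lo : ∀ s t ω, s ≤ t → 0 ≤ (∫ u in Set.Ioc (0:ℝ) t, (a u ω)^2) -
      (∫ u in Set.Ioc (0:ℝ) s, (a u ω)^2) := by
    intro s t ω hst
    rw [hdiff s t ω hst]
    exact integral_nonneg fun u => sq_nonneg _
  have hi : ∀ s t ω, s ≤ t → (∫ u in Set.Ioc (0:ℝ) t, (a u ω)^2) -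
      (∫ u in Set.Ioc (0:ℝ) s, (a u ω)^2) ≤ K ^ 2 * (t - s) := by
    intro s t ω hst
    rw [hdiff s t ω hst]
    have hsub : Set.Ioc (0:ℝ) t \ Set.Ioc 0 s ⊆ Set.Ioc s t := fun x hx =>
      ⟨by by_contra hxs; exact hx.2 ⟨hx.1.1, not_lt.1 hxs⟩, hx.1.2⟩
    have hfin : volume (Set.Ioc (0:ℝ) t \ Set.Ioc 0 s) < ⊤ :=
      (measure_mono hsub).trans_lt measure_Ioc_lt_top
    have h1 := norm_setIntegral_le_of_norm_le_const (f := fun u => a u ω ^ 2) (C := K ^ 2) hfin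
      (fun u _ => by rw [Real.norm_of_nonneg (sq_nonneg _)]; exact hsq _ _)
    refine (le_abs_self _).trans (h1.trans ?_)
    gcongr
    calc _ ≤ volume.real (Set.Ioc s t) := measureReal_mono hsub measure_Ioc_lt_top.ne
      _ = t - s := by simp [hst]
  refine ⟨hN, hQ, hc, fun t => ?_, lo, hi⟩
  have hm : AEStronglyMeasurable (fun ω => ∫ s in Set.Ioc (0:ℝ) t, (a s ω)^2) μ := by
    have h1 := ((hN.integrable t).aestronglyMeasurable.pow 2).sub
      (hQ.integrable t).aestronglyMeasurable
    refine h1.congr (Filter.Eventually.of_forall fun ω => ?_)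
    simp
  refine Integrable.of_bound hm (K ^ 2 * max t 0) (Filter.Eventually.of_forall fun ω => ?_)
  rw [Real.norm_of_nonneg (integral_nonneg fun u => sq_nonneg _)]
  rcases le_total t 0 with ht | ht
  · rw [Set.Ioc_eq_empty (by linarith)]
    simp; positivity
  · have := hi 0 t ω ht
    rw [max_eq_left ht]
    simpa using this

/-- For `M` the Doléans–Dade exponential of `∫ a dB` (with `a` bounded adapted; the
stochastic integral `N = ∫ a dB` is characterized by the martingale properties:
`N` is a continuous martingale with `N₀ = 0` and `N² − ∫ a² ds` is a martingale) and
`Y_t = M_t (∫₀^t e^{−(t−s)} M_s⁻² ds)^{1/2}`, one has `sup_{t ≥ 1} E(Y_t) < ∞`,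
with a bound `C` depending only on the uniform bound `K` on `a`. -/
theorem sup_expectation_Y_lt_top (K : ℝ) :
    ∃ C : ℝ, ∀ (Ω : Type) (mΩ : MeasurableSpace Ω) (μ : Measure Ω),
      IsProbabilityMeasure μ → ∀ (ℱ : Filtration ℝ mΩ) (a N M Y : ℝ → Ω → ℝ),
      (∀ s ω, |a s ω| ≤ K) →
      ProgMeasurable ℱ a →
      Martingale N ℱ μ →
      (∀ ω, N 0 ω = 0) →
      (∀ ω, Continuous fun t => N t ω) →
      Martingale (fun t ω => N t ω ^ 2 - ∫ s in Set.Ioc (0:ℝ) t, (a s ω)^2) ℱ μ →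
      (∀ t ω, M t ω =
        Real.exp (N t ω - (1/2) * ∫ s in Set.Ioc (0:ℝ) t, (a s ω)^2)) →
      (∀ t ω, Y t ω = M t ω *
        Real.sqrt (∫ s in Set.Ioc (0:ℝ) t, Real.exp (-(t-s)) * ((M s ω)⁻¹)^2)) →
      ∀ t : ℝ, 1 ≤ t → ∫ ω, Y t ω ∂μ ≤ C := by
  refine ⟨3 * (1 + Real.exp (K ^ 2)), ?_⟩
  intro Ω mΩ μ hμ ℱ a N M Y ha hp hN _ hc hQ hM hY t _
  have h := aux_qvdata ha hp hN hc hQ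
  set A : ℝ → Ω → ℝ := fun t ω => ∫ s in Set.Ioc (0:ℝ) t, (a s ω)^2 with hA
  have hM' : M = QVData.MM N A := by
    ext t ω; rw [hM]; rfl
  subst hM'
  have hY0 : ∀ ω, 0 ≤ Y t ω := fun ω => by
    rw [hY]; exact mul_nonneg (QVData.MM_pos _ _).le (Real.sqrt_nonneg _)
  obtain ⟨n, hn⟩ := exists_nat_ge t
  have hpt : ∀ ω, ENNReal.ofReal (Y t ω) ≤ ENNReal.ofReal (QVData.MM N A t ω) *
      (QVData.H N A (t - n) t ω) ^ (1 / 2 : ℝ) := by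
    intro ω
    rw [hY, ENNReal.ofReal_mul (QVData.MM_pos _ _).le, Real.sqrt_eq_rpow,
      ← ENNReal.ofReal_rpow_of_nonneg (integral_nonneg fun s => by positivity) (by norm_num)]
    gcongr
    refine (aux_ofReal_integral_le fun s => by positivity).trans ?_
    exact lintegral_mono_set (Set.Ioc_subset_Ioc_left (by linarith))
  have hfin : ENNReal.ofReal (∫ ω, Y t ω ∂μ) ≤ ENNReal.ofReal (3 * (1 + Real.exp (K ^ 2))) :=
    (aux_ofReal_integral_le hY0).trans
      ((lintegral_mono hpt).trans (h.all_blocks (sq_nonneg K) n t))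
  exact (ENNReal.ofReal_le_ofReal_iff (by positivity)).1 hfin
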